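/- arXiv:2306.14661 — 4 statements merged into one kernel-verified Lean document; each statement's English description precedes it below -/
import Mathlib

section
/- The map ψ ↦ z_BQP(exp(ψ)) (exp applied componentwise) is convex on R^n; that is, the g-scaled BQP bound z_BQP(Υ) is convex in log Υ. (Theorem 1.iii, second part) -/
open Matrix
open scoped Matrix BigOperators

noncomputable section

/-- `F_BQP(x,X;Υ) = (Diag(Υ) C Diag(Υ)) ∘ X + Diag(e−x)`. -/
def FBQP (n : ℕ) (C : Matrix (Fin n) (Fin n) ℝ) (x : Fin n → ℝ)
    (X : Matrix (Fin n) (Fin n) ℝ) (Υ : Fin n → ℝ) : Matrix (Fin n) (Fin n) ℝ :=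
  ((Matrix.diagonal Υ * C * Matrix.diagonal Υ) ⊙ X) + Matrix.diagonal (fun i => 1 - x i)

/-- `f_BQP(x,X;Υ) = ldet F_BQP(x,X;Υ) − 2 Σ_i x_i log γ_i`. -/
def fBQP (n : ℕ) (C : Matrix (Fin n) (Fin n) ℝ) (x : Fin n → ℝ)
    (X : Matrix (Fin n) (Fin n) ℝ) (Υ : Fin n → ℝ) : ℝ :=
  Real.log (FBQP n C x X Υ).det - 2 * ∑ i, x i * Real.log (Υ i)

/-- The set of objective values of feasible points of the g-scaled BQP relaxation:
`(x,X) ∈ P(n,s) ∩ dom(f_BQP;Υ)` and `Ax ≤ b`. -/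
def SBQP (n m : ℕ) (C : Matrix (Fin n) (Fin n) ℝ) (A : Matrix (Fin m) (Fin n) ℝ)
    (b : Fin m → ℝ) (s : ℕ) (Υ : Fin n → ℝ) : Set ℝ :=
  { v : ℝ | ∃ (x : Fin n → ℝ) (X : Matrix (Fin n) (Fin n) ℝ),
      X.IsSymm ∧ (X - Matrix.vecMulVec x x).PosSemidef ∧ X.diag = x ∧
      (∑ i, x i) = (s : ℝ) ∧ (∀ i, (∑ j, X i j) = (s : ℝ) * x i) ∧
      (∀ i, (∑ j, A i j * x j) ≤ b i) ∧ (FBQP n C x X Υ).PosDef ∧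
      v = fBQP n C x X Υ }

/-- The g-scaled BQP bound `z_BQP(Υ)`. -/
def zBQP (n m : ℕ) (C : Matrix (Fin n) (Fin n) ℝ) (A : Matrix (Fin m) (Fin n) ℝ)
    (b : Fin m → ℝ) (s : ℕ) (Υ : Fin n → ℝ) : ℝ :=
  sSup (SBQP n m C A b s Υ)

/-- Weighted log-sum-exp is convex: the inequality along a segment. -/
lemma log_sum_mul_exp_le {σ : Type*} [Fintype σ] {c u v : σ → ℝ} {a b : ℝ}
    (hc : ∀ i, 0 ≤ c i) (ha : 0 ≤ a) (hb : 0 ≤ b) (hab : a + b = 1)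
    (hu : 0 < ∑ i, c i * Real.exp (u i)) (hv : 0 < ∑ i, c i * Real.exp (v i))
    (huv : 0 < ∑ i, c i * Real.exp (a * u i + b * v i)) :
    Real.log (∑ i, c i * Real.exp (a * u i + b * v i)) ≤
      a * Real.log (∑ i, c i * Real.exp (u i)) + b * Real.log (∑ i, c i * Real.exp (v i)) := by
  set p := ∑ i, c i * Real.exp (u i) with hp
  set q := ∑ i, c i * Real.exp (v i) with hq
  set K := Real.exp (a * Real.log p + b * Real.log q) with hK
  rw [Real.log_le_iff_le_exp huv]
  have hterm : ∀ i, c i * Real.exp (a * u i + b * v i) ≤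
      K * (a / p * (c i * Real.exp (u i)) + b / q * (c i * Real.exp (v i))) := by
    intro i
    have hconv := convexOn_exp.2 (Set.mem_univ (u i - Real.log p))
      (Set.mem_univ (v i - Real.log q)) ha hb hab
    simp only [smul_eq_mul, Real.exp_sub, Real.exp_log hu, Real.exp_log hv] at hconv
    have hsplit : Real.exp (a * u i + b * v i) =
        K * Real.exp (a * (u i - Real.log p) + b * (v i - Real.log q)) := by
      rw [hK, ← Real.exp_add]
      ring_nf
    calc c i * Real.exp (a * u i + b * v i)
        = c i * K * Real.exp (a * (u i - Real.log p) + b * (v i - Real.log q)) := by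
          rw [hsplit, mul_assoc]
      _ ≤ c i * K * (a * (Real.exp (u i) / p) + b * (Real.exp (v i) / q)) :=
          mul_le_mul_of_nonneg_left hconv (mul_nonneg (hc i) (Real.exp_pos _).le)
      _ = _ := by ring
  calc _ ≤ ∑ i, K * (a / p * (c i * Real.exp (u i)) + b / q * (c i * Real.exp (v i))) :=
        Finset.sum_le_sum fun i _ => hterm i
    _ = K * (a / p * p + b / q * q) := by
        rw [← Finset.mul_sum, Finset.sum_add_distrib, ← Finset.mul_sum, ← Finset.mul_sum]
    _ = K := by rw [div_mul_cancel₀ _ hu.ne', div_mul_cancel₀ _ hv.ne', hab, mul_one]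

/-- A determinant whose rows come from a positive semidefinite matrix on `S` and from a
nonnegative diagonal matrix off `S` is nonnegative. -/
lemma det_piecewise_diagonal_nonneg {ι : Type*} [Fintype ι] [DecidableEq ι]
    {M : Matrix ι ι ℝ} (hM : M.PosSemidef) {d : ι → ℝ} (hd : ∀ i, 0 ≤ d i) (S : Finset ι) :
    0 ≤ (Matrix.of (S.piecewise M (Matrix.diagonal d))).det := by
  rw [Matrix.twoBlockTriangular_det _ (fun i => i ∈ S)]
  · refine mul_nonneg ?_ ?_
    · have h : (Matrix.of (S.piecewise M (Matrix.diagonal d))).toSquareBlockProp (fun i => i ∈ S) =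
          M.submatrix Subtype.val Subtype.val := by
        ext i j
        simp [Matrix.toSquareBlockProp, Finset.piecewise, i.2]
      rw [h]
      convert! (hM.submatrix (Subtype.val : {i // i ∈ S} → ι)).det_nonneg
    · have h : (Matrix.of (S.piecewise M (Matrix.diagonal d))).toSquareBlockProp (fun i => i ∉ S) =
          Matrix.diagonal (fun i : {i // i ∉ S} => d i) := by
        ext i j
        simp [Matrix.toSquareBlockProp, Finset.piecewise, i.2, Matrix.diagonal_apply,
          Subtype.ext_iff]
      rw [h, Matrix.det_diagonal]
      exact Finset.prod_nonneg fun i _ => hd i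
  · intro i hi j hj
    have hij : i ≠ j := fun h => hi (h ▸ hj)
    simp [Finset.piecewise, hi, hij]

/-- The determinant of `Diag(exp ψ) M Diag(exp ψ) + Diag d` as a sum of exponentials of
linear functions of `ψ`. -/
lemma det_exp_scale_add_diagonal {ι : Type*} [Fintype ι] [DecidableEq ι]
    (M : Matrix ι ι ℝ) (d ψ : ι → ℝ) :
    (Matrix.diagonal (fun i => Real.exp (ψ i)) * M * Matrix.diagonal (fun i => Real.exp (ψ i)) +
      Matrix.diagonal d).det =
    ∑ S : Finset ι, (Matrix.of (S.piecewise M (Matrix.diagonal d))).det *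
      Real.exp (2 * ∑ i ∈ S, ψ i) := by
  refine (Matrix.detRowAlternating.map_add_univ _ _).trans (Finset.sum_congr rfl fun S _ => ?_)
  set l : ι → ℝ := fun i => if i ∈ S then ψ i else -ψ i with hl
  have hfac : Matrix.of (S.piecewise (Matrix.diagonal (fun i => Real.exp (ψ i)) * M *
        Matrix.diagonal (fun i => Real.exp (ψ i))) (Matrix.diagonal d)) =
      Matrix.diagonal (fun i => Real.exp (l i)) *
        Matrix.of (S.piecewise M (Matrix.diagonal d)) *
        Matrix.diagonal (fun i => Real.exp (ψ i)) := by
    ext i j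
    by_cases hi : i ∈ S
    · simp [Finset.piecewise, hi, hl]
    · by_cases hij : i = j
      · subst hij
        simp only [Finset.piecewise, hi, hl, Matrix.of_apply, if_false, Matrix.mul_diagonal,
          Matrix.diagonal_mul, Matrix.diagonal_apply_eq]
        rw [mul_right_comm, ← Real.exp_add]
        simp
      · simp [Finset.piecewise, hi, hij]
  have hsum : ∑ i, l i + ∑ i, ψ i = 2 * ∑ i ∈ S, ψ i := by
    rw [← Finset.sum_add_distrib, Finset.mul_sum, ← Finset.sum_subset S.subset_univ]
    · exact Finset.sum_congr rfl fun i hi => by simp [hl, hi, two_mul]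
    · intro i _ hi
      simp [hl, hi]
  refine (congrArg Matrix.det hfac).trans ?_
  rw [Matrix.det_mul, Matrix.det_mul, Matrix.det_diagonal, Matrix.det_diagonal,
    ← Real.exp_sum, ← Real.exp_sum, ← hsum, Real.exp_add]
  ring

lemma FBQP_eq_scale (n : ℕ) (C : Matrix (Fin n) (Fin n) ℝ) (x : Fin n → ℝ)
    (X : Matrix (Fin n) (Fin n) ℝ) (Υ : Fin n → ℝ) :
    FBQP n C x X Υ = Matrix.diagonal Υ * (C ⊙ X) * Matrix.diagonal Υ +
      Matrix.diagonal (fun i => 1 - x i) := by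
  ext i j
  simp only [FBQP, Matrix.add_apply, Matrix.hadamard_apply, Matrix.mul_diagonal,
    Matrix.diagonal_mul]
  ring

/-- For fixed `(x, X)` the matrix `F_BQP(x, X; Υ)` is positive definite for every positive
scaling vector as soon as it is for one. -/
lemma FBQP_posDef_of_posDef {n : ℕ} {C : Matrix (Fin n) (Fin n) ℝ} {x : Fin n → ℝ}
    {X : Matrix (Fin n) (Fin n) ℝ} (hM : (C ⊙ X).PosSemidef) (hx : ∀ i, 0 ≤ 1 - x i)
    {ψ : Fin n → ℝ} (h : (FBQP n C x X fun i => Real.exp (ψ i)).PosDef) (φ : Fin n → ℝ) :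
    (FBQP n C x X fun i => Real.exp (φ i)).PosDef := by
  have hpsd : (FBQP n C x X fun i => Real.exp (φ i)).PosSemidef := by
    rw [FBQP_eq_scale]
    refine Matrix.PosSemidef.add ?_ (Matrix.PosSemidef.diagonal hx)
    simpa using hM.mul_mul_conjTranspose_same (Matrix.diagonal fun i => Real.exp (φ i))
  rw [hpsd.posDef_iff_det_ne_zero]
  have hpos := h.det_pos
  rw [FBQP_eq_scale, det_exp_scale_add_diagonal] at hpos ⊢
  have hc := det_piecewise_diagonal_nonneg hM hx
  obtain ⟨S, -, hS⟩ := Finset.exists_lt_of_sum_lt (f := fun _ => (0 : ℝ)) (by simpa using hpos)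
  refine (Finset.sum_pos' (fun T _ => mul_nonneg (hc T) (Real.exp_pos _).le)
    ⟨S, Finset.mem_univ S, mul_pos ?_ (Real.exp_pos _)⟩).ne'
  exact pos_of_mul_pos_left hS (Real.exp_pos _).le

/-- For fixed `(x, X)` the objective is convex in the logarithm of the scaling vector. -/
lemma fBQP_exp_le {n : ℕ} {C : Matrix (Fin n) (Fin n) ℝ} {x : Fin n → ℝ}
    {X : Matrix (Fin n) (Fin n) ℝ} (hM : (C ⊙ X).PosSemidef) (hx : ∀ i, 0 ≤ 1 - x i)
    {ψ φ : Fin n → ℝ} {a b : ℝ} (ha : 0 ≤ a) (hb : 0 ≤ b) (hab : a + b = 1)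
    (h : (FBQP n C x X fun i => Real.exp ((a • ψ + b • φ) i)).PosDef) :
    fBQP n C x X (fun i => Real.exp ((a • ψ + b • φ) i)) ≤
      a * fBQP n C x X (fun i => Real.exp (ψ i)) + b * fBQP n C x X (fun i => Real.exp (φ i)) := by
  have hψ := (FBQP_posDef_of_posDef hM hx h ψ).det_pos
  have hφ := (FBQP_posDef_of_posDef hM hx h φ).det_pos
  have hmid := h.det_pos
  have hlin : ∀ S : Finset (Fin n), 2 * ∑ i ∈ S, (a • ψ + b • φ) i =
      a * (2 * ∑ i ∈ S, ψ i) + b * (2 * ∑ i ∈ S, φ i) := by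
    intro S
    simp only [Pi.add_apply, Pi.smul_apply, smul_eq_mul, Finset.sum_add_distrib, ← Finset.mul_sum]
    ring
  have hlog : ∑ i, x i * (a • ψ + b • φ) i = a * ∑ i, x i * ψ i + b * ∑ i, x i * φ i := by
    simp only [Pi.add_apply, Pi.smul_apply, smul_eq_mul, Finset.mul_sum, ← Finset.sum_add_distrib]
    exact Finset.sum_congr rfl fun i _ => by ring
  simp only [fBQP, Real.log_exp]
  rw [hlog]
  simp only [FBQP_eq_scale, det_exp_scale_add_diagonal, hlin] at hψ hφ hmid ⊢
  linarith [log_sum_mul_exp_le (det_piecewise_diagonal_nonneg hM hx) ha hb hab hψ hφ hmid]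

/-- Theorem 1.iii (second part): assuming the supremum defining `z_BQP(Υ)` is finite and
attained for every `Υ ∈ ℝⁿ₊₊`, the map `ψ ↦ z_BQP(exp ψ)` is convex on `ℝⁿ`,
i.e. `z_BQP(Υ)` is convex in `log Υ`. -/
theorem stmt_3 (n m s : ℕ) (hn : 1 < n) (hs0 : 0 < s) (hsn : s < n)
    (C : Matrix (Fin n) (Fin n) ℝ) (hC : C.PosSemidef)
    (A : Matrix (Fin m) (Fin n) ℝ) (b : Fin m → ℝ)
    (hattained : ∀ Υ : Fin n → ℝ, (∀ i, 0 < Υ i) →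
      IsGreatest (SBQP n m C A b s Υ) (zBQP n m C A b s Υ)) :
    ConvexOn ℝ Set.univ
      (fun ψ : Fin n → ℝ => zBQP n m C A b s (fun i => Real.exp (ψ i))) := by
  refine ⟨convex_univ, fun ψ _ φ _ t u ht hu htu => ?_⟩
  obtain ⟨x, X, hsymm, hX, hdiag, hsum, hXe, hA, hF, hval⟩ :=
    (hattained (fun i => Real.exp ((t • ψ + u • φ) i)) fun i => Real.exp_pos _).1
  have hXpsd : X.PosSemidef := by
    simpa using hX.add (Matrix.posSemidef_vecMulVec_self_star x)
  have hM : (C ⊙ X).PosSemidef := hC.hadamard hXpsd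
  have hx : ∀ i, 0 ≤ 1 - x i := by
    intro i
    have h1 : 0 ≤ X i i - x i * x i := hX.diag_nonneg (i := i)
    have h2 : X i i = x i := congrFun hdiag i
    nlinarith [sq_nonneg (1 - x i)]
  have hle : ∀ χ : Fin n → ℝ, fBQP n C x X (fun i => Real.exp (χ i)) ≤
      zBQP n m C A b s (fun i => Real.exp (χ i)) := fun χ =>
    (hattained _ fun i => Real.exp_pos _).2
      ⟨x, X, hsymm, hX, hdiag, hsum, hXe, hA, FBQP_posDef_of_posDef hM hx hF χ, rfl⟩
  simp only [smul_eq_mul]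
  rw [hval]
  exact (fBQP_exp_le hM hx ht hu htu hF).trans (add_le_add
    (mul_le_mul_of_nonneg_left (hle ψ) ht) (mul_le_mul_of_nonneg_left (hle φ) hu))

end
end

section
/- For every scaling vector Υ ∈ R^n_{++}, the function x ↦ f_linx(x;Υ) is concave on the convex set dom(f_linx;Υ) = {x ∈ R^n : Diag(Υ) C Diag(x) C Diag(Υ) + Diag(e−x) ≻ 0}. (Theorem 2.ii, concavity part) -/
open Matrix
open scoped Matrix BigOperators

noncomputable section

/-- `F_linx(x;Υ) = Diag(Υ) C Diag(x) C Diag(Υ) + Diag(e−x)`. -/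
def FLinx (n : ℕ) (C : Matrix (Fin n) (Fin n) ℝ) (x Υ : Fin n → ℝ) :
    Matrix (Fin n) (Fin n) ℝ :=
  Matrix.diagonal Υ * C * Matrix.diagonal x * C * Matrix.diagonal Υ +
    Matrix.diagonal (fun i => 1 - x i)

/-- `f_linx(x;Υ) = (1/2) ldet F_linx(x;Υ) − Σ_i x_i log γ_i`. -/
def fLinx (n : ℕ) (C : Matrix (Fin n) (Fin n) ℝ) (x Υ : Fin n → ℝ) : ℝ :=
  (1 / 2 : ℝ) * Real.log (FLinx n C x Υ).det - ∑ i, x i * Real.log (Υ i)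

theorem Matrix.convex_setOf_posDef {ι : Type*} : Convex ℝ {M : Matrix ι ι ℝ | M.PosDef} := by
  rw [convex_iff_forall_pos]
  intro A hA B hB a b ha hb _
  exact (hA.smul ha).add (hB.smul hb)

section LogDet

variable {ι : Type*} [Fintype ι] [DecidableEq ι]

theorem Matrix.PosDef.log_det_le_trace_sub_card {M : Matrix ι ι ℝ} (hM : M.PosDef) :
    Real.log M.det ≤ M.trace - Fintype.card ι := by
  rw [hM.isHermitian.det_eq_prod_eigenvalues, hM.isHermitian.trace_eq_sum_eigenvalues]
  simp only [RCLike.ofReal_real_eq_id, id_eq]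
  rw [Real.log_prod fun i _ => (hM.eigenvalues_pos i).ne']
  calc ∑ i, Real.log (hM.isHermitian.eigenvalues i)
      ≤ ∑ i, (hM.isHermitian.eigenvalues i - 1) :=
        Finset.sum_le_sum fun i _ => Real.log_le_sub_one_of_pos (hM.eigenvalues_pos i)
    _ = _ := by simp [Finset.sum_sub_distrib]

open scoped MatrixOrder in
theorem Matrix.PosDef.exists_isUnit_conjTranspose_mul_mul_eq_one {M : Matrix ι ι ℝ}
    (hM : M.PosDef) : ∃ T : Matrix ι ι ℝ, IsUnit T ∧ Tᴴ * M * T = 1 := by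
  obtain ⟨S, hS, rfl⟩ := CStarAlgebra.isStrictlyPositive_iff_eq_star_mul_self.mp
    hM.isStrictlyPositive
  obtain ⟨u, rfl⟩ := hS
  refine ⟨↑u⁻¹, Units.isUnit _, ?_⟩
  rw [star_eq_conjTranspose, ← mul_assoc, ← conjTranspose_mul, Units.mul_inv,
    conjTranspose_one, one_mul, Units.mul_inv]

theorem Matrix.concaveOn_log_det :
    ConcaveOn ℝ {M : Matrix ι ι ℝ | M.PosDef} (fun M => Real.log M.det) := by
  refine ⟨convex_setOf_posDef, ?_⟩
  intro A hA B hB a b ha hb hab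
  have hY : (a • A + b • B).PosDef := convex_setOf_posDef hA hB ha hb hab
  obtain ⟨T, hT, hTY⟩ := hY.exists_isUnit_conjTranspose_mul_mul_eq_one
  have hdT : T.det ≠ 0 := ((isUnit_iff_isUnit_det T).mp hT).ne_zero
  have log_det_conj : ∀ X : Matrix ι ι ℝ, X.PosDef →
      Real.log (Tᴴ * X * T).det = Real.log X.det + 2 * Real.log T.det := by
    intro X hX
    rw [det_mul, det_mul, det_conjTranspose, star_trivial,
      Real.log_mul (mul_ne_zero hdT hX.det_pos.ne') hdT, Real.log_mul hdT hX.det_pos.ne']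
    ring
  have log_det_le : ∀ X : Matrix ι ι ℝ, X.PosDef →
      Real.log X.det + 2 * Real.log T.det ≤ (Tᴴ * X * T).trace - Fintype.card ι := by
    intro X hX
    rw [← log_det_conj X hX]
    exact (hX.conjTranspose_mul_mul_same
      (mulVec_injective_of_isUnit hT)).log_det_le_trace_sub_card
  have hYlog := log_det_conj _ hY
  have hYtr : a * (Tᴴ * A * T).trace + b * (Tᴴ * B * T).trace = Fintype.card ι := by
    rw [← trace_one (n := ι) (R := ℝ), ← hTY]
    simp [mul_add, add_mul, trace_add]
  rw [hTY, det_one, Real.log_one] at hYlog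
  have hsum := add_le_add (mul_le_mul_of_nonneg_left (log_det_le A hA) ha)
    (mul_le_mul_of_nonneg_left (log_det_le B hB) hb)
  obtain rfl : b = 1 - a := by linarith
  simp only [smul_eq_mul]
  linarith

end LogDet

theorem FLinx_convex_combination (n : ℕ) (C : Matrix (Fin n) (Fin n) ℝ) (Υ x y : Fin n → ℝ)
    {a b : ℝ} (hab : a + b = 1) :
    FLinx n C (a • x + b • y) Υ = a • FLinx n C x Υ + b • FLinx n C y Υ := by
  have hdiag : diagonal (fun i => 1 - (a • x + b • y) i) =
      a • diagonal (fun i => 1 - x i) + b • diagonal (fun i => 1 - y i) := by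
    rw [← diagonal_smul, ← diagonal_smul, diagonal_add]
    congr 1
    ext i
    simp only [Pi.add_apply, Pi.smul_apply, smul_eq_mul]
    linear_combination -hab
  have hlin : diagonal (a • x + b • y) = a • diagonal x + b • diagonal y := by
    rw [← diagonal_smul, ← diagonal_smul, diagonal_add]
    rfl
  simp only [FLinx]
  rw [hdiag, hlin]
  simp only [mul_add, add_mul, mul_smul_comm, smul_mul_assoc, smul_add]
  abel

/-- Theorem 2.ii (concavity part): `f_linx(·;Υ)` is concave on
`dom(f_linx;Υ) = {x ∈ ℝⁿ : F_linx(x;Υ) ≻ 0}`. -/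
theorem stmt_5 (n : ℕ) (hn : 1 < n)
    (C : Matrix (Fin n) (Fin n) ℝ) (hC : C.PosSemidef)
    (Υ : Fin n → ℝ) (hΥ : ∀ i, 0 < Υ i) :
    ConcaveOn ℝ {x : Fin n → ℝ | (FLinx n C x Υ).PosDef}
      (fun x => fLinx n C x Υ) := by
  have hconv : Convex ℝ {x : Fin n → ℝ | (FLinx n C x Υ).PosDef} := by
    intro x hx y hy a b ha hb hab
    change (FLinx n C (a • x + b • y) Υ).PosDef
    rw [FLinx_convex_combination n C Υ x y hab]
    exact convex_setOf_posDef hx hy ha hb hab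
  refine ⟨hconv, ?_⟩
  intro x hx y hy a b ha hb hab
  have hlog := concaveOn_log_det.2 hx hy ha hb hab
  have hsum : ∑ i, (a • x + b • y) i * Real.log (Υ i) =
      a * ∑ i, x i * Real.log (Υ i) + b * ∑ i, y i * Real.log (Υ i) := by
    rw [Finset.mul_sum, Finset.mul_sum, ← Finset.sum_add_distrib]
    refine Finset.sum_congr rfl fun i _ => ?_
    simp only [Pi.add_apply, Pi.smul_apply, smul_eq_mul]
    ring
  simp only [fLinx, smul_eq_mul, hsum, FLinx_convex_combination n C Υ x y hab] at hlog ⊢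
  linarith

end
end

section
/- The map ψ ↦ z_linx(exp(ψ)) (exp applied componentwise) is convex on R^n; that is, the g-scaled linx bound z_linx(Υ) is convex in log Υ. (Theorem 2.iii, second part) -/
open Matrix
open scoped Matrix BigOperators

noncomputable section

/-- The set of objective values of feasible points of the g-scaled linx relaxation. -/
def SLinx (n m : ℕ) (C : Matrix (Fin n) (Fin n) ℝ) (A : Matrix (Fin m) (Fin n) ℝ)
    (b : Fin m → ℝ) (s : ℕ) (Υ : Fin n → ℝ) : Set ℝ :=
  { v : ℝ | ∃ x : Fin n → ℝ, (∑ i, x i) = (s : ℝ) ∧ (∀ i, 0 ≤ x i) ∧ (∀ i, x i ≤ 1) ∧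
      (∀ i, (∑ j, A i j * x j) ≤ b i) ∧ (FLinx n C x Υ).PosDef ∧ v = fLinx n C x Υ }

/-- The g-scaled linx bound `z_linx(Υ)`. -/
def zLinx (n m : ℕ) (C : Matrix (Fin n) (Fin n) ℝ) (A : Matrix (Fin m) (Fin n) ℝ)
    (b : Fin m → ℝ) (s : ℕ) (Υ : Fin n → ℝ) : ℝ :=
  sSup (SLinx n m C A b s Υ)

/-- The matrix whose rows indexed by `S` are those of `M`, the others those of `diagonal d`. -/
def Matrix.rowsOrDiagonal {n : ℕ} (M : Matrix (Fin n) (Fin n) ℝ) (d : Fin n → ℝ)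
    (S : Finset (Fin n)) : Matrix (Fin n) (Fin n) ℝ :=
  Matrix.of fun i j => if i ∈ S then M i j else diagonal d i j

theorem Matrix.det_add_diagonal_eq_sum {n : ℕ} (M : Matrix (Fin n) (Fin n) ℝ) (d : Fin n → ℝ) :
    (M + diagonal d).det = ∑ S : Finset (Fin n), (rowsOrDiagonal M d S).det := by
  refine ((detRowAlternating (n := Fin n) (R := ℝ)).toMultilinearMap.map_add_univ
    M (diagonal d)).trans (Finset.sum_congr rfl fun S _ => ?_)
  refine congrArg (detRowAlternating (n := Fin n) (R := ℝ)) (funext fun i => funext fun j => ?_)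
  by_cases hi : i ∈ S
  · exact (congrFun (Finset.piecewise_eq_of_mem S _ _ hi) j).trans (if_pos hi).symm
  · exact (congrFun (Finset.piecewise_eq_of_notMem S _ _ hi) j).trans (if_neg hi).symm

theorem Matrix.rowsOrDiagonal_exp_scaling {n : ℕ} (M : Matrix (Fin n) (Fin n) ℝ)
    (d ψ : Fin n → ℝ) (S : Finset (Fin n)) :
    rowsOrDiagonal (diagonal (fun i => Real.exp (ψ i)) * M *
        diagonal (fun i => Real.exp (ψ i))) d S =
      diagonal (fun i => Real.exp (if i ∈ S then ψ i else -ψ i)) * rowsOrDiagonal M d S *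
        diagonal (fun i => Real.exp (ψ i)) := by
  ext i j
  simp only [rowsOrDiagonal, mul_diagonal, diagonal_mul, of_apply]
  by_cases hi : i ∈ S
  · simp only [if_pos hi]
  · simp only [if_neg hi]
    by_cases hij : i = j
    · subst hij
      rw [mul_right_comm, ← Real.exp_add]
      simp
    · simp [diagonal_apply_ne _ hij]

theorem Matrix.det_rowsOrDiagonal_exp_scaling {n : ℕ} (M : Matrix (Fin n) (Fin n) ℝ)
    (d ψ : Fin n → ℝ) (S : Finset (Fin n)) :
    (rowsOrDiagonal (diagonal (fun i => Real.exp (ψ i)) * M *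
        diagonal (fun i => Real.exp (ψ i))) d S).det =
      (rowsOrDiagonal M d S).det * Real.exp (∑ i ∈ S, 2 * ψ i) := by
  rw [rowsOrDiagonal_exp_scaling, det_mul, det_mul, det_diagonal, det_diagonal, mul_right_comm,
    mul_comm, ← Real.exp_sum, ← Real.exp_sum, ← Real.exp_add, ← Finset.sum_add_distrib]
  congr 2
  rw [← Finset.sum_subset (Finset.subset_univ S)]
  · refine Finset.sum_congr rfl fun i hi => ?_
    rw [if_pos hi]
    ring
  · intro i _ hi
    simp [hi]

theorem Matrix.PosSemidef.det_rowsOrDiagonal_nonneg {n : ℕ} {M : Matrix (Fin n) (Fin n) ℝ}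
    (hM : M.PosSemidef) {d : Fin n → ℝ} (hd : ∀ i, 0 ≤ d i) (S : Finset (Fin n)) :
    0 ≤ (rowsOrDiagonal M d S).det := by
  rw [twoBlockTriangular_det _ (fun i => i ∈ S)]
  · refine mul_nonneg ?_ ?_
    · have h : toSquareBlockProp (rowsOrDiagonal M d S) (fun i => i ∈ S) =
          M.submatrix Subtype.val Subtype.val := by
        ext i j
        exact if_pos i.2
      rw [h]
      convert (hM.submatrix (Subtype.val : {i // i ∈ S} → Fin n)).det_nonneg
      rfl
    · have h : toSquareBlockProp (rowsOrDiagonal M d S) (fun i => ¬ i ∈ S) =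
          diagonal (fun i : {i // ¬ i ∈ S} => d i) := by
        ext i j
        refine (if_neg i.2).trans ?_
        simp [diagonal_apply, Subtype.ext_iff]
      rw [h, det_diagonal]
      exact Finset.prod_nonneg fun i _ => hd i
  · intro i hi j hj
    exact (if_neg hi).trans (diagonal_apply_ne _ fun h => hi (h ▸ hj))

theorem Real.log_sum_mul_exp_le {ι : Type*} [Fintype ι] {c : ι → ℝ} (hc : ∀ i, 0 ≤ c i)
    (p q : ι → ℝ) {t u : ℝ} (ht : 0 ≤ t) (hu : 0 ≤ u) (htu : t + u = 1)
    (hp : 0 < ∑ i, c i * Real.exp (p i)) (hq : 0 < ∑ i, c i * Real.exp (q i))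
    (hpq : 0 < ∑ i, c i * Real.exp (t * p i + u * q i)) :
    Real.log (∑ i, c i * Real.exp (t * p i + u * q i)) ≤
      t * Real.log (∑ i, c i * Real.exp (p i)) + u * Real.log (∑ i, c i * Real.exp (q i)) := by
  set P := ∑ i, c i * Real.exp (p i) with hP
  set Q := ∑ i, c i * Real.exp (q i) with hQ
  rw [Real.log_le_iff_le_exp hpq]
  have hterm : ∀ i, c i * Real.exp (t * p i + u * q i) ≤
      Real.exp (t * Real.log P + u * Real.log Q) *
        (t * (c i * Real.exp (p i) / P) + u * (c i * Real.exp (q i) / Q)) := by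
    intro i
    have h := convexOn_exp.2 (Set.mem_univ (p i - Real.log P)) (Set.mem_univ (q i - Real.log Q))
      ht hu htu
    simp only [smul_eq_mul] at h
    rw [Real.exp_sub, Real.exp_sub, Real.exp_log hp, Real.exp_log hq] at h
    have he : t * p i + u * q i = (t * Real.log P + u * Real.log Q) +
        (t * (p i - Real.log P) + u * (q i - Real.log Q)) := by ring
    rw [he, Real.exp_add]
    refine (mul_le_mul_of_nonneg_left (mul_le_mul_of_nonneg_left h (Real.exp_pos _).le)
      (hc i)).trans (le_of_eq ?_)
    ring
  refine (Finset.sum_le_sum fun i _ => hterm i).trans (le_of_eq ?_)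
  rw [← Finset.mul_sum, Finset.sum_add_distrib, ← Finset.mul_sum, ← Finset.mul_sum,
    ← Finset.sum_div, ← Finset.sum_div, ← hP, ← hQ, div_self hp.ne', div_self hq.ne', mul_one,
    mul_one, htu, mul_one]

theorem FLinx_exp_det_eq {n : ℕ} (C : Matrix (Fin n) (Fin n) ℝ) (x ψ : Fin n → ℝ) :
    (FLinx n C x (fun i => Real.exp (ψ i))).det =
      ∑ S : Finset (Fin n),
        (rowsOrDiagonal (C * diagonal x * C) (fun i => 1 - x i) S).det *
          Real.exp (∑ i ∈ S, 2 * ψ i) := by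
  simp only [← det_rowsOrDiagonal_exp_scaling, ← det_add_diagonal_eq_sum, FLinx,
    Matrix.mul_assoc]

theorem Matrix.PosSemidef.mul_diagonal_mul_self {n : ℕ} {C : Matrix (Fin n) (Fin n) ℝ}
    (hC : C.PosSemidef) {x : Fin n → ℝ} (hx : ∀ i, 0 ≤ x i) :
    (C * diagonal x * C).PosSemidef := by
  have h := (PosSemidef.diagonal (d := x) hx).mul_mul_conjTranspose_same C
  rwa [hC.isHermitian.eq] at h

theorem FLinx_posSemidef {n : ℕ} {C : Matrix (Fin n) (Fin n) ℝ} (hC : C.PosSemidef)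
    {x : Fin n → ℝ} (hx0 : ∀ i, 0 ≤ x i) (hx1 : ∀ i, x i ≤ 1) (Υ : Fin n → ℝ) :
    (FLinx n C x Υ).PosSemidef := by
  have h := (hC.mul_diagonal_mul_self hx0).mul_mul_conjTranspose_same (diagonal Υ)
  rw [diagonal_conjTranspose, star_trivial] at h
  have hd : (diagonal fun i => 1 - x i).PosSemidef :=
    PosSemidef.diagonal fun i => sub_nonneg.2 (hx1 i)
  simpa only [FLinx, Matrix.mul_assoc] using h.add hd

theorem FLinx_exp_posDef {n : ℕ} {C : Matrix (Fin n) (Fin n) ℝ} (hC : C.PosSemidef)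
    {x : Fin n → ℝ} (hx0 : ∀ i, 0 ≤ x i) (hx1 : ∀ i, x i ≤ 1) {ψ φ : Fin n → ℝ}
    (h : (FLinx n C x (fun i => Real.exp (ψ i))).PosDef) :
    (FLinx n C x (fun i => Real.exp (φ i))).PosDef := by
  have hc := (hC.mul_diagonal_mul_self hx0).det_rowsOrDiagonal_nonneg
    (fun i => sub_nonneg.2 (hx1 i))
  have hpos := h.det_pos
  rw [FLinx_exp_det_eq] at hpos
  obtain ⟨S, -, hS⟩ := Finset.exists_ne_zero_of_sum_ne_zero hpos.ne'
  rw [(FLinx_posSemidef hC hx0 hx1 _).posDef_iff_isUnit, isUnit_iff_isUnit_det, isUnit_iff_ne_zero,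
    FLinx_exp_det_eq]
  refine (Finset.sum_pos' (fun T _ => mul_nonneg (hc T) (Real.exp_pos _).le)
    ⟨S, Finset.mem_univ S, ?_⟩).ne'
  exact mul_pos ((hc S).lt_of_ne' (left_ne_zero_of_mul hS)) (Real.exp_pos _)

theorem fLinx_exp_le {n : ℕ} {C : Matrix (Fin n) (Fin n) ℝ} (hC : C.PosSemidef)
    {x : Fin n → ℝ} (hx0 : ∀ i, 0 ≤ x i) (hx1 : ∀ i, x i ≤ 1) {ψ φ : Fin n → ℝ} {t u : ℝ}
    (ht : 0 ≤ t) (hu : 0 ≤ u) (htu : t + u = 1)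
    (h : (FLinx n C x (fun i => Real.exp ((t • ψ + u • φ) i))).PosDef) :
    fLinx n C x (fun i => Real.exp ((t • ψ + u • φ) i)) ≤
      t * fLinx n C x (fun i => Real.exp (ψ i)) + u * fLinx n C x (fun i => Real.exp (φ i)) := by
  have hc := (hC.mul_diagonal_mul_self hx0).det_rowsOrDiagonal_nonneg
    (fun i => sub_nonneg.2 (hx1 i))
  have hexp : ∀ S : Finset (Fin n), ∑ i ∈ S, 2 * (t • ψ + u • φ) i =
      t * ∑ i ∈ S, 2 * ψ i + u * ∑ i ∈ S, 2 * φ i := by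
    intro S
    rw [Finset.mul_sum, Finset.mul_sum, ← Finset.sum_add_distrib]
    refine Finset.sum_congr rfl fun i _ => ?_
    simp only [Pi.add_apply, Pi.smul_apply, smul_eq_mul]
    ring
  have hψ := (FLinx_exp_posDef hC hx0 hx1 (φ := ψ) h).det_pos
  have hφ := (FLinx_exp_posDef hC hx0 hx1 (φ := φ) h).det_pos
  have hm := h.det_pos
  rw [FLinx_exp_det_eq] at hψ hφ hm
  simp only [hexp] at hm
  have hlog := Real.log_sum_mul_exp_le hc _ _ ht hu htu hψ hφ hm
  have hlin : ∑ i, x i * (t • ψ + u • φ) i =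
      t * ∑ i, x i * ψ i + u * ∑ i, x i * φ i := by
    rw [Finset.mul_sum, Finset.mul_sum, ← Finset.sum_add_distrib]
    refine Finset.sum_congr rfl fun i _ => ?_
    simp only [Pi.add_apply, Pi.smul_apply, smul_eq_mul]
    ring
  simp only [fLinx, Real.log_exp, FLinx_exp_det_eq, hlin, hexp]
  linarith

/-- Theorem 2.iii (second part): assuming the supremum defining `z_linx(Υ)` is finite and
attained for every `Υ ∈ ℝⁿ₊₊`, the map `ψ ↦ z_linx(exp ψ)` is convex on `ℝⁿ`,
i.e. `z_linx(Υ)` is convex in `log Υ`. -/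
theorem stmt_7 (n m s : ℕ) (hn : 1 < n) (hs0 : 0 < s) (hsn : s < n)
    (C : Matrix (Fin n) (Fin n) ℝ) (hC : C.PosSemidef)
    (A : Matrix (Fin m) (Fin n) ℝ) (b : Fin m → ℝ)
    (hattained : ∀ Υ : Fin n → ℝ, (∀ i, 0 < Υ i) →
      IsGreatest (SLinx n m C A b s Υ) (zLinx n m C A b s Υ)) :
    ConvexOn ℝ Set.univ
      (fun ψ : Fin n → ℝ => zLinx n m C A b s (fun i => Real.exp (ψ i))) := by
  refine ⟨convex_univ, fun ψ _ φ _ t u ht hu htu => ?_⟩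
  have hz := fun χ : Fin n → ℝ => hattained (fun i => Real.exp (χ i)) fun i => Real.exp_pos _
  obtain ⟨x, hsum, hx0, hx1, hAx, hpd, hval⟩ := (hz (t • ψ + u • φ)).1
  have hle : ∀ χ : Fin n → ℝ, fLinx n C x (fun i => Real.exp (χ i)) ≤
      zLinx n m C A b s (fun i => Real.exp (χ i)) := fun χ =>
    (hz χ).2 ⟨x, hsum, hx0, hx1, hAx, FLinx_exp_posDef hC hx0 hx1 hpd, rfl⟩
  simp only [smul_eq_mul]
  rw [hval]
  exact (fLinx_exp_le hC hx0 hx1 ht hu htu hpd).trans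
    (add_le_add (mul_le_mul_of_nonneg_left (hle ψ) ht) (mul_le_mul_of_nonneg_left (hle φ) hu))

end
end

section
/- For every scaling vector Υ ∈ R^n_{++}, the function x ↦ f_DDFact(x;Υ) is concave on the convex set dom(f_DDFact;Υ)_+ = {x ∈ R^n : x ≥ 0, rank(F^⊤ Diag(Υ∘x) F) ≥ s}. (Theorem 3.ii) -/
open Matrix
open scoped Matrix BigOperators Classical

noncomputable section

/-- `(1/(s−ι)) Σ_{ℓ=ι+1}^k λ_ℓ` (eigenvalues indexed from `1`). -/
def avgTail (k s : ℕ) (lam : ℕ → ℝ) (ι : ℕ) : ℝ :=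
  (∑ ℓ ∈ Finset.Icc (ι + 1) k, lam ℓ) / ((s : ℝ) - ι)

/-- The defining property of the unique index `ι` of Lemma 1
(with the convention `λ_0 = +∞`, so for `ι = 0` the left inequality is vacuous). -/
def IsIota (k s : ℕ) (lam : ℕ → ℝ) (ι : ℕ) : Prop :=
  ι < s ∧ (1 ≤ ι → avgTail k s lam ι < lam ι) ∧ lam (ι + 1) ≤ avgTail k s lam ι

/-- The unique index `ι` of Lemma 1 (junk value `0` if no such index exists). -/
def iotaOf (k s : ℕ) (lam : ℕ → ℝ) : ℕ :=
  if h : ∃ ι, IsIota k s lam ι then h.choose else 0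

/-- `φ_s(λ) = Σ_{ℓ=1}^ι log λ_ℓ + (s−ι) log((1/(s−ι)) Σ_{ℓ=ι+1}^k λ_ℓ)`. -/
def phiS (k s : ℕ) (lam : ℕ → ℝ) : ℝ :=
  (∑ ℓ ∈ Finset.Icc 1 (iotaOf k s lam), Real.log (lam ℓ)) +
    ((s : ℝ) - iotaOf k s lam) * Real.log (avgTail k s lam (iotaOf k s lam))

/-- The decreasingly ordered eigenvalues of a symmetric matrix, indexed from `1`
(junk value `0` outside `[1,k]` or if `X` is not Hermitian). -/
def eigsDesc (k : ℕ) (X : Matrix (Fin k) (Fin k) ℝ) : ℕ → ℝ := fun i =>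
  if h : X.IsHermitian then
    ((((List.ofFn h.eigenvalues : List ℝ) : Multiset ℝ).sort (· ≤ ·)).reverse).getD (i - 1) 0
  else 0

/-- `Γ_s(X) = φ_s(λ(X))` with `λ(X)` the decreasingly ordered eigenvalues of `X`. -/
def gammaS (k s : ℕ) (X : Matrix (Fin k) (Fin k) ℝ) : ℝ :=
  phiS k s (eigsDesc k X)

/-- `F_DDFact(x;Υ) = Fᵀ Diag(Υ∘x) F = Σ_i γ_i x_i F_{i·}ᵀ F_{i·}`. -/
def FDD (n k : ℕ) (F : Matrix (Fin n) (Fin k) ℝ) (x Υ : Fin n → ℝ) :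
    Matrix (Fin k) (Fin k) ℝ :=
  Fᵀ * Matrix.diagonal (fun i => Υ i * x i) * F

/-- `f_DDFact(x;Υ) = Γ_s(F_DDFact(x;Υ)) − Σ_i x_i log γ_i`. -/
def fDD (n k s : ℕ) (F : Matrix (Fin n) (Fin k) ℝ) (x Υ : Fin n → ℝ) : ℝ :=
  gammaS k s (FDD n k F x Υ) - ∑ i, x i * Real.log (Υ i)

/-- `β` of Definition 1: `β_i = 1/λ_i` for `i ≤ ι` and
`β_i = (s−ι)/Σ_{ℓ=ι+1}^k λ_ℓ` for `i > ι` (here `β` is indexed by `Fin k`, `j ↔ j+1`). -/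
def betaOf (k s : ℕ) (lam : ℕ → ℝ) : Fin k → ℝ := fun j =>
  if (j : ℕ) + 1 ≤ iotaOf k s lam then (lam ((j : ℕ) + 1))⁻¹
  else ((s : ℝ) - iotaOf k s lam) / ∑ ℓ ∈ Finset.Icc (iotaOf k s lam + 1) k, lam ℓ

/-- `F Q Diag(β) Qᵀ Fᵀ`, whose diagonal appears in the (generalized) gradients. -/
def gMat (n k s : ℕ) (F : Matrix (Fin n) (Fin k) ℝ) (Q : Matrix (Fin k) (Fin k) ℝ)
    (lam : ℕ → ℝ) : Matrix (Fin n) (Fin n) ℝ :=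
  F * Q * Matrix.diagonal (betaOf k s lam) * Qᵀ * Fᵀ

/-- `Q, λ` form a spectral decomposition of `F_DDFact(x;Υ)` as in Definition 1:
`Q` orthonormal and `F_DDFact(x;Υ) = Q Diag(λ) Qᵀ` with `λ` decreasing and nonnegative
(indexed from `1`). -/
def IsSpectralDecomp (n k : ℕ) (F : Matrix (Fin n) (Fin k) ℝ) (x Υ : Fin n → ℝ)
    (Q : Matrix (Fin k) (Fin k) ℝ) (lam : ℕ → ℝ) : Prop :=
  Q * Qᵀ = 1 ∧
  FDD n k F x Υ = Q * Matrix.diagonal (fun j : Fin k => lam ((j : ℕ) + 1)) * Qᵀ ∧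
  (∀ i, 0 ≤ lam i) ∧
  (∀ i j, 1 ≤ i → i ≤ j → j ≤ k → lam j ≤ lam i)

/-- Euclidean (2-)norm of a vector in `ℝⁿ`. -/
def enorm2 (n : ℕ) (v : Fin n → ℝ) : ℝ :=
  Real.sqrt (∑ i, (v i) ^ 2)

/-- `lam` with the entries beyond `iotaOf k s lam` replaced by their tail average. -/
def leveled (k s : ℕ) (lam : ℕ → ℝ) (i : ℕ) : ℝ :=
  if i ≤ iotaOf k s lam then lam i else avgTail k s lam (iotaOf k s lam)

theorem sum_Icc_one_add_sum_Icc {m k : ℕ} (h : m ≤ k) (f : ℕ → ℝ) :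
    ∑ i ∈ Finset.Icc 1 m, f i + ∑ i ∈ Finset.Icc (m + 1) k, f i = ∑ i ∈ Finset.Icc 1 k, f i := by
  simp only [Finset.Icc_add_one_left_eq_Ioc, show Finset.Icc 1 = Finset.Ioc 0 from
    funext (Finset.Icc_add_one_left_eq_Ioc 0)]
  exact Finset.sum_Ioc_consecutive f (Nat.zero_le m) h

section Vectors

variable {k s : ℕ} {lam : ℕ → ℝ}

theorem isIota_iotaOf (hs : 0 < s) (hsk : s ≤ k) (h0 : ∀ i, 0 ≤ lam i) :
    IsIota k s lam (iotaOf k s lam) := by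
  have hlast : lam (s - 1 + 1) ≤ avgTail k s lam (s - 1) := by
    have hmem : s - 1 + 1 ∈ Finset.Icc (s - 1 + 1) k := by simp; omega
    have h1 := Finset.single_le_sum (f := lam) (fun i _ => h0 i) hmem
    have h2 : (s : ℝ) - (s - 1 : ℕ) = 1 := by
      rw [Nat.cast_sub (by omega)]; simp
    rw [avgTail, h2, div_one]
    exact h1
  have hex : ∃ ι, lam (ι + 1) ≤ avgTail k s lam ι := ⟨s - 1, hlast⟩
  have hP := Nat.find_spec hex
  have hlt : Nat.find hex < s := (Nat.find_min' hex hlast).trans_lt (by omega)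
  have hfind : ∃ ι, IsIota k s lam ι := by
    refine ⟨Nat.find hex, hlt, fun h1 => ?_, hP⟩
    obtain ⟨m, hm⟩ : ∃ m, Nat.find hex = m + 1 := ⟨Nat.find hex - 1, by omega⟩
    have hmin := Nat.find_min hex (m := m) (by omega)
    rw [hm] at hlt ⊢
    have hms : ((m + 1 : ℕ) : ℝ) < s := by exact_mod_cast hlt
    push_cast at hms
    have hsum : ∑ ℓ ∈ Finset.Icc (m + 1) k, lam ℓ
        = lam (m + 1) + ∑ ℓ ∈ Finset.Icc (m + 1 + 1) k, lam ℓ := by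
      rw [Finset.Icc_add_one_left_eq_Ioc (m + 1)]
      exact (Finset.add_sum_Ioc_eq_sum_Icc (f := lam) (by omega : m + 1 ≤ k)).symm
    rw [avgTail, not_le, div_lt_iff₀ (by linarith), hsum] at hmin
    rw [avgTail, div_lt_iff₀ (by push_cast; linarith)]
    push_cast
    linarith
  rw [iotaOf, dif_pos hfind]
  exact hfind.choose_spec

theorem avgTail_mul (h : iotaOf k s lam < s) :
    ((s : ℝ) - iotaOf k s lam) * avgTail k s lam (iotaOf k s lam)
      = ∑ ℓ ∈ Finset.Icc (iotaOf k s lam + 1) k, lam ℓ := by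
  have : (iotaOf k s lam : ℝ) < s := by exact_mod_cast h
  rw [avgTail, mul_div_cancel₀]
  linarith

theorem sum_comp_leveled (hs : 0 < s) (hsk : s ≤ k) (h0 : ∀ i, 0 ≤ lam i)
    (g : ℝ → ℝ) :
    ∑ i ∈ Finset.Icc 1 s, g (leveled k s lam i) = ∑ i ∈ Finset.Icc 1 (iotaOf k s lam), g (lam i) +
      ((s : ℝ) - iotaOf k s lam) * g (avgTail k s lam (iotaOf k s lam)) := by
  have hι := (isIota_iotaOf hs hsk h0).1
  rw [← sum_Icc_one_add_sum_Icc hι.le]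
  congr 1
  · refine Finset.sum_congr rfl fun i hi => ?_
    rw [leveled, if_pos (Finset.mem_Icc.1 hi).2]
  · rw [Finset.sum_congr rfl (g := fun _ => g (avgTail k s lam (iotaOf k s lam))) fun i hi => ?_]
    · rw [Finset.sum_const, Nat.card_Icc, nsmul_eq_mul, Nat.add_sub_add_right, Nat.cast_sub hι.le]
    · rw [leveled, if_neg (by have := (Finset.mem_Icc.1 hi).1; omega)]

theorem phiS_eq_sum_log_leveled (hs : 0 < s) (hsk : s ≤ k) (h0 : ∀ i, 0 ≤ lam i) :
    phiS k s lam = ∑ i ∈ Finset.Icc 1 s, Real.log (leveled k s lam i) :=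
  (sum_comp_leveled hs hsk h0 Real.log).symm

theorem sum_leveled (hs : 0 < s) (hsk : s ≤ k) (h0 : ∀ i, 0 ≤ lam i) :
    ∑ i ∈ Finset.Icc 1 s, leveled k s lam i = ∑ i ∈ Finset.Icc 1 k, lam i := by
  have hι := (isIota_iotaOf hs hsk h0).1
  rw [sum_comp_leveled hs hsk h0 (fun x => x), avgTail_mul hι,
    sum_Icc_one_add_sum_Icc (hι.le.trans hsk)]

theorem le_leveled (hs : 0 < s) (hsk : s ≤ k) (hanti : Antitone lam) (h0 : ∀ i, 0 ≤ lam i)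
    (i : ℕ) : lam i ≤ leveled k s lam i := by
  rw [leveled]
  split_ifs with h
  · exact le_rfl
  · exact (hanti (by omega)).trans (isIota_iotaOf hs hsk h0).2.2

theorem leveled_antitone (hs : 0 < s) (hsk : s ≤ k) (hanti : Antitone lam) (h0 : ∀ i, 0 ≤ lam i)
    {i j : ℕ} (hi : 1 ≤ i) (hij : i ≤ j) :
    leveled k s lam j ≤ leveled k s lam i := by
  have hι := isIota_iotaOf hs hsk h0
  by_cases hj : j ≤ iotaOf k s lam
  · rw [leveled, leveled, if_pos hj, if_pos (hij.trans hj)]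
    exact hanti hij
  · by_cases h : i ≤ iotaOf k s lam
    · rw [leveled, leveled, if_neg hj, if_pos h]
      exact (hι.2.1 (hi.trans h)).le.trans (hanti h)
    · rw [leveled, leveled, if_neg hj, if_neg h]

theorem leveled_pos (hs : 0 < s) (hsk : s ≤ k) (hanti : Antitone lam) (h0 : ∀ i, 0 ≤ lam i)
    (hpos : 0 < lam s) (i : ℕ) : 0 < leveled k s lam i := by
  have hι := (isIota_iotaOf hs hsk h0).1
  rw [leveled]
  split_ifs with h
  · exact hpos.trans_le (hanti (h.trans hι.le))
  · have hι' : (iotaOf k s lam : ℝ) < s := by exact_mod_cast hι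
    refine div_pos (hpos.trans_le ?_) (by linarith)
    exact Finset.single_le_sum (f := lam) (fun i _ => h0 i) (Finset.mem_Icc.2 ⟨hι, hsk⟩)

theorem sum_mul_inv_leveled (hs : 0 < s) (hsk : s ≤ k) (hanti : Antitone lam) (h0 : ∀ i, 0 ≤ lam i)
    (hpos : 0 < lam s) :
    ∑ i ∈ Finset.Icc 1 k, lam i * (leveled k s lam i)⁻¹ = s := by
  have hι := (isIota_iotaOf hs hsk h0).1
  have hι' : (iotaOf k s lam : ℝ) < s := by exact_mod_cast hι
  have hl := leveled_pos hs hsk hanti h0 hpos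
  have h1 : ∑ i ∈ Finset.Icc 1 (iotaOf k s lam), lam i * (leveled k s lam i)⁻¹
      = iotaOf k s lam := by
    rw [Finset.sum_congr rfl (g := fun _ => (1 : ℝ)) fun i hi => ?_]
    · simp
    · have h := hl i
      rw [leveled, if_pos (Finset.mem_Icc.1 hi).2] at h ⊢
      exact mul_inv_cancel₀ h.ne'
  have h2 : ∑ i ∈ Finset.Icc (iotaOf k s lam + 1) k, lam i * (leveled k s lam i)⁻¹
      = s - iotaOf k s lam := by
    have hA := hl (iotaOf k s lam + 1)
    rw [leveled, if_neg (by omega)] at hA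
    rw [Finset.sum_congr rfl
      (g := fun i => lam i * (avgTail k s lam (iotaOf k s lam))⁻¹) fun i hi => ?_]
    · rw [← Finset.sum_mul, ← avgTail_mul hι, mul_inv_cancel_right₀ hA.ne']
    · rw [leveled, if_neg (by have := (Finset.mem_Icc.1 hi).1; omega)]
  rw [← sum_Icc_one_add_sum_Icc (hι.le.trans hsk), h1, h2]
  ring

/-- The reciprocals of `leveled k s lam` form a supergradient of `phiS` at `lam`. -/
theorem phiS_le_add_sum_mul_inv_leveled (hs : 0 < s) (hsk : s ≤ k) (hanti : Antitone lam)
    (h0 : ∀ i, 0 ≤ lam i) (hpos : 0 < lam s) {mu : ℕ → ℝ} (hmu : Antitone mu)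
    (hmu0 : ∀ i, 0 ≤ mu i) (hmupos : 0 < mu s) :
    phiS k s mu ≤ phiS k s lam + ∑ i ∈ Finset.Icc 1 k, mu i * (leveled k s lam i)⁻¹ - s := by
  have hl := leveled_pos hs hsk hanti h0 hpos
  have hm := leveled_pos hs hsk hmu hmu0 hmupos
  have hle := le_leveled hs hsk hmu hmu0
  have hι := (isIota_iotaOf hs hsk h0).1
  have hlog : phiS k s mu ≤ phiS k s lam
      + ∑ i ∈ Finset.Icc 1 s, leveled k s mu i * (leveled k s lam i)⁻¹ - s := by
    have : (s : ℝ) = ∑ i ∈ Finset.Icc 1 s, (1 : ℝ) := by simp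
    rw [phiS_eq_sum_log_leveled hs hsk h0, phiS_eq_sum_log_leveled hs hsk hmu0, this,
      ← Finset.sum_add_distrib, ← Finset.sum_sub_distrib]
    refine Finset.sum_le_sum fun i _ => ?_
    have h := Real.log_le_sub_one_of_pos (mul_pos (hm i) (inv_pos.2 (hl i)))
    rw [Real.log_mul (hm i).ne' (inv_pos.2 (hl i)).ne', Real.log_inv] at h
    linarith
  have hsplit := sum_Icc_one_add_sum_Icc hsk fun i => mu i * (leveled k s lam i)⁻¹
  have hbound : ∑ i ∈ Finset.Icc 1 s, (leveled k s mu i - mu i) * (leveled k s lam i)⁻¹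
      ≤ ∑ i ∈ Finset.Icc 1 s, (leveled k s mu i - mu i) * (leveled k s lam s)⁻¹ := by
    refine Finset.sum_le_sum fun i hi => mul_le_mul_of_nonneg_left ?_ (sub_nonneg.2 (hle i))
    obtain ⟨hi1, hi2⟩ := Finset.mem_Icc.1 hi
    exact inv_anti₀ (hl s) (leveled_antitone hs hsk hanti h0 hi1 hi2)
  have htail : ∑ i ∈ Finset.Icc (s + 1) k, mu i * (leveled k s lam i)⁻¹
      = (∑ i ∈ Finset.Icc (s + 1) k, mu i) * (leveled k s lam s)⁻¹ := by
    rw [Finset.sum_mul]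
    refine Finset.sum_congr rfl fun i hi => ?_
    rw [leveled, leveled, if_neg (by have := (Finset.mem_Icc.1 hi).1; omega), if_neg (by omega)]
  have hsum : ∑ i ∈ Finset.Icc 1 s, leveled k s mu i - ∑ i ∈ Finset.Icc 1 s, mu i
      = ∑ i ∈ Finset.Icc (s + 1) k, mu i := by
    rw [sum_leveled hs hsk hmu0, ← sum_Icc_one_add_sum_Icc hsk]
    ring
  rw [← Finset.sum_mul, Finset.sum_sub_distrib, hsum, ← htail] at hbound
  simp only [sub_mul, Finset.sum_sub_distrib] at hbound
  linarith

end Vectors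

section Matrices

variable {k : ℕ}

theorem Antivary.sum_mul_le_sum_sum_mul_of_mem_doublyStochastic {b m : Fin k → ℝ}
    (h : Antivary b m) {W : Matrix (Fin k) (Fin k) ℝ} (hW : W ∈ doublyStochastic ℝ (Fin k)) :
    ∑ i, b i * m i ≤ ∑ i, ∑ j, b i * m j * W i j := by
  let L : Matrix (Fin k) (Fin k) ℝ →ₗ[ℝ] ℝ :=
    { toFun := fun W => ∑ i, ∑ j, b i * m j * W i j
      map_add' := fun A B => by simp [mul_add, Finset.sum_add_distrib]
      map_smul' := fun c A => by
        simp only [Matrix.smul_apply, smul_eq_mul, RingHom.id_apply, Finset.mul_sum]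
        exact Finset.sum_congr rfl fun i _ => Finset.sum_congr rfl fun j _ => by ring }
  have hW' : W ∈ (doublyStochastic ℝ (Fin k) : Set (Matrix (Fin k) (Fin k) ℝ)) := hW
  rw [doublyStochastic_eq_convexHull_permMatrix] at hW'
  refine convexHull_min (t := {W | ∑ i, b i * m i ≤ L W}) ?_
    (convex_halfSpace_ge L.isLinear _) hW'
  rintro _ ⟨σ, rfl⟩
  refine (h.sum_mul_le_sum_mul_comp_perm (σ := σ)).trans_eq ?_
  refine Finset.sum_congr rfl fun i _ => ?_
  simp [Equiv.Perm.permMatrix, PEquiv.toMatrix_apply]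

theorem sq_mem_doublyStochastic {Q : Matrix (Fin k) (Fin k) ℝ} (hQ : Q * Qᵀ = 1) :
    (Matrix.of fun i j => Q i j ^ 2) ∈ doublyStochastic ℝ (Fin k) := by
  have hQ' : Qᵀ * Q = 1 := mul_eq_one_comm.1 hQ
  refine mem_doublyStochastic_iff_sum.2 ⟨fun i j => sq_nonneg _, fun i => ?_, fun j => ?_⟩
  · simpa [Matrix.mul_apply, sq] using congrFun (congrFun hQ i) i
  · simpa [Matrix.mul_apply, sq] using congrFun (congrFun hQ' j) j

/-- A lower bound for the trace of a product of symmetric matrices in terms of oppositely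
ordered eigenvalues. -/
theorem Antivary.sum_mul_le_trace_mul {b m : Fin k → ℝ} (h : Antivary b m)
    {P Q : Matrix (Fin k) (Fin k) ℝ} (hP : P * Pᵀ = 1) (hQ : Q * Qᵀ = 1) :
    ∑ i, b i * m i ≤ (P * diagonal b * Pᵀ * (Q * diagonal m * Qᵀ)).trace := by
  have hR : (Pᵀ * Q) * (Pᵀ * Q)ᵀ = 1 := by
    rw [transpose_mul, transpose_transpose, Matrix.mul_assoc, ← Matrix.mul_assoc Q, hQ,
      Matrix.one_mul, mul_eq_one_comm.1 hP]
  refine (h.sum_mul_le_sum_sum_mul_of_mem_doublyStochastic (sq_mem_doublyStochastic hR)).trans_eq ?_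
  have htr : (P * diagonal b * Pᵀ * (Q * diagonal m * Qᵀ)).trace
      = ((diagonal b * (Pᵀ * Q)) * (diagonal m * (Pᵀ * Q)ᵀ)).trace := by
    rw [transpose_mul, transpose_transpose]
    simp only [Matrix.mul_assoc]
    rw [trace_mul_comm P]
    simp only [Matrix.mul_assoc]
  rw [htr, trace]
  refine Finset.sum_congr rfl fun i _ => ?_
  rw [diag_apply, Matrix.mul_apply]
  refine Finset.sum_congr rfl fun j _ => ?_
  rw [diagonal_mul, diagonal_mul, transpose_apply, of_apply]
  ring

theorem eigsDesc_succ {X : Matrix (Fin k) (Fin k) ℝ} (hX : X.IsHermitian) :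
    ∃ σ : Equiv.Perm (Fin k), Antitone (hX.eigenvalues ∘ σ) ∧
      ∀ i, eigsDesc k X (i + 1) = (List.ofFn (hX.eigenvalues ∘ σ)).getD i 0 := by
  let σ : Equiv.Perm (Fin k) := Fin.revPerm.trans (Tuple.sort hX.eigenvalues)
  have hσ : Antitone (hX.eigenvalues ∘ σ) := fun i j hij =>
    Tuple.monotone_sort hX.eigenvalues (Fin.rev_le_rev.2 hij)
  refine ⟨σ, hσ, fun i => ?_⟩
  have hl : (((List.ofFn hX.eigenvalues : List ℝ) : Multiset ℝ).sort (· ≤ ·)).reverse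
      = List.ofFn (hX.eigenvalues ∘ σ) := by
    refine List.Perm.eq_of_pairwise (le := (· ≥ ·)) (fun a b _ _ h1 h2 => le_antisymm h2 h1)
      (List.pairwise_reverse.2 (Multiset.pairwise_sort _ _)) hσ.sortedGE_ofFn.pairwise ?_
    refine (List.reverse_perm _).trans (List.Perm.trans ?_ (σ.ofFn_comp_perm _).symm)
    exact Multiset.coe_eq_coe.1 (Multiset.sort_eq _ _)
  rw [eigsDesc, dif_pos hX, hl, Nat.add_sub_cancel]

theorem exists_eq_mul_diagonal_eigsDesc_mul {X : Matrix (Fin k) (Fin k) ℝ} (hX : X.IsHermitian) :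
    ∃ Q : Matrix (Fin k) (Fin k) ℝ, Q * Qᵀ = 1 ∧
      X = Q * diagonal (fun j : Fin k => eigsDesc k X (j + 1)) * Qᵀ := by
  obtain ⟨σ, -, h⟩ := eigsDesc_succ hX
  have hd : (fun j : Fin k => eigsDesc k X (j + 1)) = hX.eigenvalues ∘ σ := by
    funext j
    simp [h]
  let U : Matrix (Fin k) (Fin k) ℝ := hX.eigenvectorUnitary
  have hU : U * Uᵀ = 1 := by
    simpa [U, star_eq_conjTranspose] using Unitary.coe_mul_star_self hX.eigenvectorUnitary
  have hsp : X = U * diagonal hX.eigenvalues * Uᵀ := by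
    have := hX.spectral_theorem
    rw [Unitary.conjStarAlgAut_apply] at this
    simpa [U, star_eq_conjTranspose] using this
  refine ⟨U.submatrix id σ, ?_, ?_⟩
  · rw [transpose_submatrix, submatrix_mul_equiv, hU, submatrix_id_id]
  · rw [hd, ← submatrix_diagonal_equiv, transpose_submatrix, submatrix_mul_equiv,
      submatrix_mul_equiv, ← hsp, submatrix_id_id]

theorem eigsDesc_nonneg {X : Matrix (Fin k) (Fin k) ℝ} (hX : X.PosSemidef) (i : ℕ) :
    0 ≤ eigsDesc k X i := by
  have key : ∀ i, 0 ≤ eigsDesc k X (i + 1) := fun i => by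
    obtain ⟨σ, -, h⟩ := eigsDesc_succ hX.isHermitian
    rw [h]
    by_cases hi : i < k
    · simpa [hi] using hX.eigenvalues_nonneg _
    · simp [hi]
  rcases i with _ | i
  · exact key 0
  · exact key i

theorem eigsDesc_antitone {X : Matrix (Fin k) (Fin k) ℝ} (hX : X.PosSemidef) :
    Antitone (eigsDesc k X) := by
  refine antitone_nat_of_succ_le fun i => ?_
  rcases i with _ | i
  · exact le_rfl
  · obtain ⟨σ, hσ, h⟩ := eigsDesc_succ hX.isHermitian
    by_cases hi : i + 1 < k
    · rw [h, h]
      have := hσ (show (⟨i, by omega⟩ : Fin k) ≤ ⟨i + 1, hi⟩ from Nat.le_succ i)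
      simpa [hi, show i < k by omega] using this
    · have : eigsDesc k X (i + 1 + 1) = 0 := by
        rw [h]
        simp [hi]
      rw [this]
      exact eigsDesc_nonneg hX _

theorem eigsDesc_pos_of_le_rank {X : Matrix (Fin k) (Fin k) ℝ} (hX : X.PosSemidef) {s : ℕ}
    (hs : 0 < s) (hr : s ≤ X.rank) : 0 < eigsDesc k X s := by
  by_contra! hle
  obtain ⟨Q, hQ, hXQ⟩ := exists_eq_mul_diagonal_eigsDesc_mul hX.isHermitian
  have hdet : IsUnit Q.det := (Matrix.isUnit_iff_isUnit_det _).1 (IsUnit.of_mul_eq_one _ hQ)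
  have hdet' : IsUnit Qᵀ.det := by rwa [det_transpose]
  have hrank : X.rank = Fintype.card {j : Fin k // eigsDesc k X (j + 1) ≠ 0} := by
    conv_lhs => rw [hXQ, rank_mul_eq_left_of_isUnit_det _ _ hdet',
      rank_mul_eq_right_of_isUnit_det _ _ hdet, rank_diagonal]
  have hlt : ∀ j : {j : Fin k // eigsDesc k X (j + 1) ≠ 0}, (j : Fin k).val < s - 1 := by
    rintro ⟨j, hj⟩
    by_contra! hge
    exact hj (le_antisymm ((eigsDesc_antitone hX (by grind)).trans hle) (eigsDesc_nonneg hX _))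
  have hcard := Fintype.card_le_of_injective
    (fun j : {j : Fin k // eigsDesc k X (j + 1) ≠ 0} => (⟨_, hlt j⟩ : Fin (s - 1)))
    fun a b hab => Subtype.ext (Fin.ext (Fin.mk.inj hab))
  rw [Fintype.card_fin] at hcard
  omega

theorem sum_Icc_one_eq_sum_fin (f : ℕ → ℝ) :
    ∑ i ∈ Finset.Icc 1 k, f i = ∑ j : Fin k, f (j + 1) := by
  rw [Fin.sum_univ_eq_sum_range (fun i => f (i + 1)), Finset.range_eq_Ico,
    Finset.sum_Ico_add' f 0 k 1, zero_add, Finset.Ico_add_one_right_eq_Icc]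

/-- The function `gammaS` has a supergradient at every positive semidefinite matrix of
rank at least `s`. -/
theorem exists_supergradient_gammaS {s : ℕ} (hs : 0 < s) {Z : Matrix (Fin k) (Fin k) ℝ}
    (hZ : Z.PosSemidef) (hZr : s ≤ Z.rank) :
    ∃ T : Matrix (Fin k) (Fin k) ℝ, (T * Z).trace = s ∧
      ∀ Y : Matrix (Fin k) (Fin k) ℝ, Y.PosSemidef → s ≤ Y.rank →
        gammaS k s Y ≤ gammaS k s Z + (T * Y).trace - s := by
  have hsk : s ≤ k := hZr.trans (by simpa using Z.rank_le_card_width)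
  have hanti := eigsDesc_antitone hZ
  have h0 := eigsDesc_nonneg hZ
  have hpos := eigsDesc_pos_of_le_rank hZ hs hZr
  obtain ⟨P, hP, hZP⟩ := exists_eq_mul_diagonal_eigsDesc_mul hZ.isHermitian
  let b : Fin k → ℝ := fun j => (leveled k s (eigsDesc k Z) (j + 1))⁻¹
  have hb : Monotone b := fun i j hij =>
    inv_anti₀ (leveled_pos hs hsk hanti h0 hpos _)
      (leveled_antitone hs hsk hanti h0 (by omega) (by simpa using hij))
  refine ⟨P * diagonal b * Pᵀ, ?_, fun Y hY hYr => ?_⟩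
  · rw [← sum_mul_inv_leveled hs hsk hanti h0 hpos, sum_Icc_one_eq_sum_fin]
    conv_lhs => rw [hZP]
    rw [show P * diagonal b * Pᵀ * (P * diagonal (fun j : Fin k => eigsDesc k Z (j + 1)) * Pᵀ)
        = P * (diagonal b * ((Pᵀ * P) * (diagonal (fun j : Fin k => eigsDesc k Z (j + 1)) * Pᵀ)))
        by simp only [Matrix.mul_assoc], mul_eq_one_comm.1 hP, Matrix.one_mul, trace_mul_comm,
      Matrix.mul_assoc, Matrix.mul_assoc, mul_eq_one_comm.1 hP, Matrix.mul_one,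
      diagonal_mul_diagonal, trace_diagonal]
    exact Finset.sum_congr rfl fun j _ => mul_comm _ _
  · obtain ⟨Q, hQ, hYQ⟩ := exists_eq_mul_diagonal_eigsDesc_mul hY.isHermitian
    have hm : Antitone fun j : Fin k => eigsDesc k Y (j + 1) := fun i j hij =>
      eigsDesc_antitone hY (by simpa using hij)
    have htr := (hb.antivary hm).sum_mul_le_trace_mul hP hQ
    rw [← hYQ] at htr
    have hphi := phiS_le_add_sum_mul_inv_leveled hs hsk hanti h0 hpos (eigsDesc_antitone hY)
      (eigsDesc_nonneg hY) (eigsDesc_pos_of_le_rank hY hs hYr)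
    rw [sum_Icc_one_eq_sum_fin] at hphi
    simp only [b, mul_comm (leveled k s (eigsDesc k Z) _)⁻¹] at htr
    rw [gammaS, gammaS]
    linarith

theorem rank_le_rank_smul_add_smul {X Y : Matrix (Fin k) (Fin k) ℝ} (hX : X.PosSemidef)
    (hY : Y.PosSemidef) {a b : ℝ} (ha : 0 < a) (hb : 0 ≤ b) : X.rank ≤ (a • X + b • Y).rank := by
  have hker : LinearMap.ker (a • X + b • Y).mulVecLin ≤ LinearMap.ker X.mulVecLin := by
    intro v hv
    rw [LinearMap.mem_ker, mulVecLin_apply] at hv ⊢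
    have h0 : a * (v ⬝ᵥ X *ᵥ v) + b * (v ⬝ᵥ Y *ᵥ v) = 0 := by
      simpa [add_mulVec, smul_mulVec, dotProduct_add, dotProduct_smul] using
        congrArg (v ⬝ᵥ ·) hv
    have hx : 0 ≤ v ⬝ᵥ X *ᵥ v := by simpa using hX.dotProduct_mulVec_nonneg v
    have hy : 0 ≤ v ⬝ᵥ Y *ᵥ v := by simpa using hY.dotProduct_mulVec_nonneg v
    refine (hX.dotProduct_mulVec_zero_iff v).1 ?_
    have := mul_nonneg hb hy
    rw [star_trivial]
    nlinarith
  have h1 := LinearMap.finrank_range_add_finrank_ker X.mulVecLin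
  have h2 := LinearMap.finrank_range_add_finrank_ker (a • X + b • Y).mulVecLin
  have h3 := Submodule.finrank_mono hker
  rw [Matrix.rank, Matrix.rank]
  omega

theorem convex_setOf_posSemidef_le_rank (s : ℕ) :
    Convex ℝ {X : Matrix (Fin k) (Fin k) ℝ | X.PosSemidef ∧ s ≤ X.rank} := by
  rintro X ⟨hX, hXr⟩ Y ⟨hY, hYr⟩ a b ha hb hab
  refine ⟨(hX.smul ha).add (hY.smul hb), ?_⟩
  rcases ha.eq_or_lt with rfl | ha
  · rw [add_comm]
    exact hYr.trans (rank_le_rank_smul_add_smul hY hX (by linarith) le_rfl)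
  · exact hXr.trans (rank_le_rank_smul_add_smul hX hY ha hb)

theorem concaveOn_gammaS {s : ℕ} (hs : 0 < s) :
    ConcaveOn ℝ {X : Matrix (Fin k) (Fin k) ℝ | X.PosSemidef ∧ s ≤ X.rank} (gammaS k s) := by
  refine ⟨convex_setOf_posSemidef_le_rank s, fun X hX Y hY a b ha hb hab => ?_⟩
  obtain ⟨hZ, hZr⟩ := convex_setOf_posSemidef_le_rank s hX hY ha hb hab
  obtain ⟨T, hT, hsup⟩ := exists_supergradient_gammaS hs hZ hZr
  have h1 := mul_le_mul_of_nonneg_left (hsup X hX.1 hX.2) ha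
  have h2 := mul_le_mul_of_nonneg_left (hsup Y hY.1 hY.2) hb
  simp only [Matrix.mul_add, Matrix.mul_smul, trace_add, trace_smul, smul_eq_mul] at hT
  rw [smul_eq_mul, smul_eq_mul]
  obtain rfl : b = 1 - a := by linarith
  linarith

theorem FDD_posSemidef {n : ℕ} (F : Matrix (Fin n) (Fin k) ℝ) {x Υ : Fin n → ℝ}
    (hx : ∀ i, 0 ≤ x i) (hΥ : ∀ i, 0 ≤ Υ i) : (FDD n k F x Υ).PosSemidef := by
  have h := (PosSemidef.diagonal (d := fun i => Υ i * x i)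
    fun i => mul_nonneg (hΥ i) (hx i)).conjTranspose_mul_mul_same F
  rwa [conjTranspose_eq_transpose_of_trivial] at h

theorem FDD_smul_add_smul {n : ℕ} (F : Matrix (Fin n) (Fin k) ℝ) (x y Υ : Fin n → ℝ) (a b : ℝ) :
    FDD n k F (a • x + b • y) Υ = a • FDD n k F x Υ + b • FDD n k F y Υ := by
  have : diagonal (fun i => Υ i * (a • x + b • y) i)
      = a • diagonal (fun i => Υ i * x i) + b • diagonal (fun i => Υ i * y i) := by
    rw [← diagonal_smul, ← diagonal_smul, diagonal_add]
    congr 1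
    funext i
    simp only [Pi.add_apply, Pi.smul_apply, smul_eq_mul]
    ring
  simp only [FDD, this, Matrix.mul_add, Matrix.add_mul, Matrix.mul_smul, Matrix.smul_mul]

end Matrices

/-- Theorem 3.ii: for every `Υ ∈ ℝⁿ₊₊`, `f_DDFact(·;Υ)` is concave on the convex set
`dom(f_DDFact;Υ)₊ = {x : x ≥ 0, rank(Fᵀ Diag(Υ∘x) F) ≥ s}`. -/
theorem stmt_10 (n k s r : ℕ) (hn : 1 < n) (hs0 : 0 < s) (hsn : s < n)
    (C : Matrix (Fin n) (Fin n) ℝ) (hC : C.PosSemidef)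
    (hr : C.rank = r) (hrs : s ≤ r)
    (F : Matrix (Fin n) (Fin k) ℝ) (hF : C = F * Fᵀ) (hk1 : r ≤ k) (hk2 : k ≤ n)
    (Υ : Fin n → ℝ) (hΥ : ∀ i, 0 < Υ i) :
    ConcaveOn ℝ {x : Fin n → ℝ | (∀ i, 0 ≤ x i) ∧ s ≤ (FDD n k F x Υ).rank}
      (fun x => fDD n k s F x Υ) := by
  have hΥ' : ∀ i, 0 ≤ Υ i := fun i => (hΥ i).le
  have hΓ := concaveOn_gammaS (k := k) hs0
  refine ⟨fun x hx y hy a b ha hb hab => ⟨fun i => ?_, ?_⟩, fun x hx y hy a b ha hb hab => ?_⟩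
  · exact add_nonneg (mul_nonneg ha (hx.1 i)) (mul_nonneg hb (hy.1 i))
  · rw [FDD_smul_add_smul]
    exact (hΓ.1 ⟨FDD_posSemidef F hx.1 hΥ', hx.2⟩ ⟨FDD_posSemidef F hy.1 hΥ', hy.2⟩
      ha hb hab).2
  · have h := hΓ.2 ⟨FDD_posSemidef F hx.1 hΥ', hx.2⟩ ⟨FDD_posSemidef F hy.1 hΥ', hy.2⟩
      ha hb hab
    have hlin : ∑ i, (a • x + b • y) i * Real.log (Υ i)
        = a * ∑ i, x i * Real.log (Υ i) + b * ∑ i, y i * Real.log (Υ i) := by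
      rw [Finset.mul_sum, Finset.mul_sum, ← Finset.sum_add_distrib]
      refine Finset.sum_congr rfl fun i _ => ?_
      simp only [Pi.add_apply, Pi.smul_apply, smul_eq_mul]
      ring
    simp only [fDD, FDD_smul_add_smul, hlin, smul_eq_mul] at h ⊢
    linarith
end
end
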